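/- Fix α > 0 and let g : [0,∞) → ℂ be continuous with t ↦ t^α g(t) bounded. Suppose u : [0,∞)×(0,∞) → ℂ is bounded, continuous on [0,∞)×(0,∞), twice continuously differentiable on (0,∞)×(0,∞), and satisfies: ∂_t u(x,t) = x^{2(α-1)/α} ∂_{xx} u(x,t) for all x, t > 0; u(0,t) = t^α g(t) for all t > 0; u(x,t) → 0 as t → 0⁺ for every x > 0; and u(x,t) → 0 as x → ∞ for every t > 0. Then u(x,t) = t^α (L_t^α g)(x) for all x, t > 0, where (L_t^α g)(x) := (α/2)^α / (Γ(α/2) t^α) ∫_0^t x (t-τ)^{-(α/2+1)} exp(-α² x^{2/α}/(4(t-τ))) g(τ) τ^α dτ. -/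

import Mathlib

open MeasureTheory Filter Set

/-- The transform
`(L_t^α g)(x) = (α/2)^α/(Γ(α/2) t^α) ∫_0^t x (t-τ)^{-(α/2+1)} exp(-α² x^{2/α}/(4(t-τ))) g(τ) τ^α dτ`. -/
noncomputable def Lt (α t : ℝ) (g : ℝ → ℂ) (x : ℝ) : ℂ :=
  (((α / 2) ^ α / (Real.Gamma (α / 2) * t ^ α) : ℝ) : ℂ) *
    ∫ τ in Set.Ioo (0 : ℝ) t,
      ((x * (t - τ) ^ (-(α / 2 + 1)) : ℝ) : ℂ) *
        ((Real.exp (-(α ^ 2) * x ^ (2 / α) / (4 * (t - τ))) : ℝ) : ℂ) *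
          g τ * ((τ ^ α : ℝ) : ℂ)

lemma secdiff (h h1 h2 : ℝ → ℂ) (y r : ℝ) (hr : 0 < r) (hry : r < y)
    (H1 : ∀ x, 0 < x → HasDerivAt h (h1 x) x) (H2 : ∀ x, 0 < x → HasDerivAt h1 (h2 x) x)
    (H3 : ContinuousOn h2 (Ioi 0)) :
    ∫ s in (0:ℝ)..r, ((r - s : ℝ) : ℂ) * (h2 (y + s) + h2 (y - s)) =
      h (y + r) + h (y - r) - 2 * h y := by
  have key := intervalIntegral.integral_eq_sub_of_hasDerivAt (a := 0) (b := r)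
    (f := fun s : ℝ => ((r - s : ℝ) : ℂ) * (h1 (y + s) - h1 (y - s)) + (h (y + s) + h (y - s)))
    (f' := fun s : ℝ => ((r - s : ℝ) : ℂ) * (h2 (y + s) + h2 (y - s))) ?_ ?_
  · rw [key]; simp; ring
  · intro s hs
    rw [uIcc_of_le hr.le] at hs
    have hp : 0 < y + s := by linarith [hs.1]
    have hm : 0 < y - s := by linarith [hs.2]
    have e1 : HasDerivAt (fun s : ℝ => ((r - s : ℝ) : ℂ)) (-1) s := by
      have := (((hasDerivAt_id s).const_sub r).ofReal_comp)
      simpa using this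
    have a1 : HasDerivAt (fun s : ℝ => y + s) 1 s := (hasDerivAt_id s).const_add y
    have a2 : HasDerivAt (fun s : ℝ => y - s) (-1) s := (hasDerivAt_id s).const_sub y
    have b1 := (H1 _ hp).scomp s a1
    have b2 := (H1 _ hm).scomp s a2
    have b3 := (H2 _ hp).scomp s a1
    have b4 := (H2 _ hm).scomp s a2
    have := (e1.mul (b3.sub b4)).add (b1.add b2)
    refine this.congr_deriv ?_
    simp
    ring
  · apply ContinuousOn.intervalIntegrable
    rw [uIcc_of_le hr.le]
    apply ContinuousOn.mul
    · fun_prop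
    · apply ContinuousOn.add
      · exact H3.comp (by fun_prop) (fun s hs => by simp only [mem_Ioi]; linarith [hs.1])
      · exact H3.comp (by fun_prop) (fun s hs => by simp only [mem_Ioi]; linarith [hs.2])

lemma maxprin (E m : ℝ → ℝ) (l : ℝ) (hl : 0 < l) (hE : ContinuousOn E (Ici 0)) (E0 : E 0 = 0)
    (hm : ContinuousOn m (Ioi 0)) (hmp : ∀ x, 0 < x → 0 < m x)
    (hb : ∃ M, ∀ x, 0 ≤ x → E x ≤ M)
    (hid : ∀ y r, 0 < r → r < y → E (y + r) + E (y - r) - 2 * E y =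
      l * ∫ s in (0:ℝ)..r, (r - s) * (m (y + s) * E (y + s) + m (y - s) * E (y - s))) :
    ∀ x, 0 ≤ x → E x ≤ 0 := by
  intro x hx
  by_contra hcon
  push Not at hcon
  have hx0 : 0 < x := by
    rcases hx.lt_or_eq with h | h
    · exact h
    · rw [← h, E0] at hcon; exact absurd hcon (lt_irrefl _)
  obtain ⟨M, hM⟩ := hb
  have hMp : 0 < M := lt_of_lt_of_le hcon (hM x hx)
  set e := E x / (2 * x) with he
  have hep : 0 < e := by positivity
  set R := max x (M / e) with hR
  have hxR : x ≤ R := le_max_left _ _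
  have hRe : M ≤ e * R := by
    have : M / e ≤ R := le_max_right _ _
    rw [div_le_iff₀ hep] at this; linarith
  have hc : ContinuousOn (fun z => E z - e * z) (Icc 0 R) :=
    (hE.mono Icc_subset_Ici_self).sub (by fun_prop)
  obtain ⟨y, hy, hmax⟩ := isCompact_Icc.exists_isMaxOn ⟨x, hx, hxR⟩ hc
  have hmax' : ∀ z, 0 ≤ z → z ≤ R → E z - e * z ≤ E y - e * y := fun z h1 h2 => hmax ⟨h1, h2⟩
  have hex : e * x = E x / 2 := by rw [he]; field_simp
  have hval : 0 < E y - e * y := by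
    have := hmax' x hx hxR
    linarith
  have hall : ∀ z, 0 ≤ z → E z - e * z ≤ E y - e * y := by
    intro z hz
    rcases le_total z R with h | h
    · exact hmax' z hz h
    · have := hM z hz
      have : e * R ≤ e * z := by gcongr
      linarith
  have hy0 : 0 < y := by
    rcases hy.1.lt_or_eq with h | h
    · exact h
    · rw [← h, E0] at hval; simp at hval
  have hEy : 0 < E y := by have := mul_pos hep hy0; linarith
  have hca : ContinuousAt E y := hE.continuousAt (Ici_mem_nhds hy0)
  have hev := hca.eventually (lt_mem_nhds hEy)
  obtain ⟨d, hd, hball⟩ := Metric.eventually_nhds_iff.1 hev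
  set r := min (d / 2) (y / 2) with hr
  have hr0 : 0 < r := by positivity
  have hrd : r < d := lt_of_le_of_lt (min_le_left _ _) (by linarith)
  have hry : r < y := lt_of_le_of_lt (min_le_right _ _) (by linarith)
  have hi := hid y r hr0 hry
  have h1 := hall (y + r) (by linarith)
  have h2 := hall (y - r) (by linarith)
  have hpos : 0 < ∫ s in (0:ℝ)..r, (r - s) * (m (y + s) * E (y + s) + m (y - s) * E (y - s)) := by
    apply intervalIntegral.intervalIntegral_pos_of_pos_on _ _ hr0
    · apply ContinuousOn.intervalIntegrable
      rw [uIcc_of_le hr0.le]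
      have hE' := hE.mono Ioi_subset_Ici_self
      have mp : MapsTo (fun s => y + s) (Icc 0 r) (Ioi 0) := fun s hs => by
        simp only [mem_Ioi]; linarith [hs.1]
      have mm : MapsTo (fun s => y - s) (Icc 0 r) (Ioi 0) := fun s hs => by
        simp only [mem_Ioi]; linarith [hs.2]
      apply ContinuousOn.mul (by fun_prop)
      exact ((hm.comp (by fun_prop) mp).mul (hE'.comp (by fun_prop) mp)).add
        ((hm.comp (by fun_prop) mm).mul (hE'.comp (by fun_prop) mm))
    · intro s hs
      have q1 : 0 < E (y + s) := hball (by
        rw [Real.dist_eq, abs_lt]; constructor <;> linarith [hs.1, hs.2])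
      have q2 : 0 < E (y - s) := hball (by
        rw [Real.dist_eq, abs_lt]; constructor <;> linarith [hs.1, hs.2])
      have q3 := hmp (y + s) (by linarith [hs.1])
      have q4 := hmp (y - s) (by linarith [hs.2])
      have q5 : 0 < r - s := by linarith [hs.2]
      positivity
  have := mul_pos hl hpos
  rw [← hi] at this
  nlinarith

lemma expint (l M : ℝ) (hl : 0 < l) :
    IntegrableOn (fun t : ℝ => Real.exp (-(l * t)) * M) (Ioi 0) := by
  have := (integrableOn_exp_mul_Ioi (neg_lt_zero.2 hl) 0).mul_const M
  simp only [neg_mul] at this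
  exact this

lemma lapint (l M : ℝ) (hl : 0 < l) (h : ℝ → ℂ) (hc : ContinuousOn h (Ioi 0))
    (hM : ∀ t, 0 < t → ‖h t‖ ≤ M) :
    IntegrableOn (fun t : ℝ => (Real.exp (-(l * t)) : ℂ) * h t) (Ioi 0) := by
  refine Integrable.mono' (expint l M hl) ?_ ?_
  · apply ContinuousOn.aestronglyMeasurable _ measurableSet_Ioi
    exact ContinuousOn.mul (by fun_prop) hc
  · filter_upwards [ae_restrict_mem measurableSet_Ioi] with t ht
    rw [norm_mul, Complex.norm_real, Real.norm_eq_abs, abs_of_pos (Real.exp_pos _)]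
    gcongr
    exact hM t ht

lemma lerch (h : ℝ → ℂ) (M : ℝ) (hc : ContinuousOn h (Ioi 0)) (hM : ∀ t, 0 < t → ‖h t‖ ≤ M)
    (hL : ∀ l : ℝ, 0 < l → ∫ t in Ioi (0:ℝ), (Real.exp (-(l * t)) : ℂ) * h t = 0) :
    ∀ t, 0 < t → h t = 0 := by
  set k : ℝ → ℂ := fun t => (Real.exp (-(1 * t)) : ℂ) * h t with hk
  have hki : IntegrableOn k (Ioi 0) := lapint 1 M one_pos h hc hM
  have hkc : ContinuousOn k (Ioi 0) := ContinuousOn.mul (by fun_prop) hc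
  have hmul : ∀ φ : ℝ → ℝ, ContinuousOn φ (Icc 0 1) →
      IntegrableOn (fun t => ((φ (Real.exp (-t)) : ℝ) : ℂ) * k t) (Ioi 0) := by
    intro φ hφ
    obtain ⟨C, hC⟩ := isCompact_Icc.exists_bound_of_continuousOn hφ
    have hmt : MapsTo (fun t : ℝ => Real.exp (-t)) (Ioi 0) (Icc 0 1) := fun t ht =>
      ⟨(Real.exp_pos _).le, Real.exp_le_one_iff.2 (by simpa using (le_of_lt ht))⟩
    refine Integrable.bdd_mul (c := C) hki ?_ ?_
    · apply ContinuousOn.aestronglyMeasurable _ measurableSet_Ioi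
      exact Complex.continuous_ofReal.comp_continuousOn (hφ.comp (by fun_prop) hmt)
    · filter_upwards [ae_restrict_mem measurableSet_Ioi] with t ht
      rw [Complex.norm_real]; exact hC _ (hmt ht)
  have hpoly : ∀ p : Polynomial ℝ,
      ∫ t in Ioi (0:ℝ), ((p.eval (Real.exp (-t)) : ℝ) : ℂ) * k t = 0 := by
    intro p
    induction p using Polynomial.induction_on' with
    | add p q hp hq =>
      have : ∀ t, (((p + q).eval (Real.exp (-t)) : ℝ) : ℂ) * k t =
          ((p.eval (Real.exp (-t)) : ℝ) : ℂ) * k t + ((q.eval (Real.exp (-t)) : ℝ) : ℂ) * k t := by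
        intro t; simp [add_mul]
      simp_rw [this]
      rw [integral_add (hmul _ p.continuous.continuousOn) (hmul _ q.continuous.continuousOn), hp, hq,
        add_zero]
    | monomial n a =>
      have : ∀ t : ℝ, (((Polynomial.monomial n a).eval (Real.exp (-t)) : ℝ) : ℂ) * k t =
          (a : ℂ) * ((Real.exp (-((n + 1 : ℝ) * t)) : ℂ) * h t) := by
        intro t
        have : Real.exp (-((n + 1 : ℝ) * t)) = Real.exp (-t) ^ n * Real.exp (-(1 * t)) := by
          rw [← Real.exp_nat_mul, ← Real.exp_add]; congr 1; ring
        rw [this]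
        simp only [Polynomial.eval_monomial, hk]
        push_cast; ring
      simp_rw [this]
      rw [integral_const_mul, hL _ (by positivity), mul_zero]
  have hcont : ∀ φ : ℝ → ℝ, ContinuousOn φ (Icc 0 1) →
      ∫ t in Ioi (0:ℝ), ((φ (Real.exp (-t)) : ℝ) : ℂ) * k t = 0 := by
    intro φ hφ
    rw [← norm_le_zero_iff]
    set C := ∫ t in Ioi (0:ℝ), ‖k t‖ with hC
    have hC0 : 0 ≤ C := integral_nonneg (fun _ => norm_nonneg _)
    have : ∀ ε > 0, ‖∫ t in Ioi (0:ℝ), ((φ (Real.exp (-t)) : ℝ) : ℂ) * k t‖ ≤ ε * C := by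
      intro ε hε
      obtain ⟨p, hp⟩ := exists_polynomial_near_of_continuousOn 0 1 φ hφ ε hε
      rw [← norm_neg, ← zero_sub, ← hpoly p, ← integral_sub (hmul _ p.continuous.continuousOn) (hmul _ hφ),
        hC, ← integral_const_mul]
      apply norm_integral_le_of_norm_le (hki.norm.const_mul ε)
      filter_upwards [ae_restrict_mem measurableSet_Ioi] with t ht
      rw [← sub_mul, norm_mul, ← Complex.ofReal_sub, Complex.norm_real]
      gcongr
      exact (hp _ ⟨(Real.exp_pos _).le, Real.exp_le_one_iff.2 (by simpa using (le_of_lt ht))⟩).le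
    apply le_of_forall_pos_le_add
    intro δ hδ
    have h1 := this (δ / (C + 1)) (by positivity)
    have : δ / (C + 1) * C ≤ δ := by
      rw [div_mul_eq_mul_div, div_le_iff₀ (by positivity)]; nlinarith
    linarith
  have hae := isOpen_Ioi.ae_eq_zero_of_integral_contDiff_smul_eq_zero (U := Ioi (0:ℝ)) (f := k)
    (μ := volume) hki.locallyIntegrableOn (by
    intro ψ hψ hs hU
    have hψ0 : ψ 0 = 0 := by
      apply image_eq_zero_of_notMem_tsupport
      intro hh; exact lt_irrefl (0:ℝ) (hU hh)
    have hneg : ∀ x, x ∉ Ioi (0:ℝ) → ψ x = 0 := fun x hx =>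
      image_eq_zero_of_notMem_tsupport (fun hh => hx (hU hh))
    have h1 := hcont (fun s => ψ (-Real.log s)) (by
      apply Continuous.continuousOn
      rw [continuous_iff_continuousAt]
      intro s
      by_cases hs0 : s = 0
      · subst hs0
        rw [continuousAt_iff_punctured_nhds]
        simp only [Real.log_zero, neg_zero, hψ0]
        have hz := hs.is_zero_at_infty
        refine hz.comp ?_
        have : Tendsto (fun s => -Real.log s) (nhdsWithin 0 {0}ᶜ) atTop :=
          tendsto_neg_atBot_atTop.comp Real.tendsto_log_nhdsNE_zero
        exact this.mono_right atTop_le_cocompact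
      · exact hψ.continuous.continuousAt.comp (Real.continuousAt_log hs0).neg)
    rw [← h1, ← setIntegral_eq_integral_of_forall_compl_eq_zero (s := Ioi (0:ℝ))]
    · simp [Complex.real_smul]
    · intro x hx; rw [hneg x hx, zero_smul])
  have heq : EqOn k 0 (Ioi 0) := by
    refine Measure.eqOn_open_of_ae_eq (μ := volume) ?_ isOpen_Ioi hkc continuousOn_const
    rw [EventuallyEq, ae_restrict_iff' measurableSet_Ioi]
    exact hae
  intro t ht
  have := heq ht
  simpa [hk, Complex.exp_ne_zero] using this

lemma lapB (w wt : ℝ → ℝ → ℂ) (r M M' l : ℝ) (hr : 0 < r) (hl : 0 < l)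
    (hw : ContinuousOn (fun p : ℝ × ℝ => w p.1 p.2) (Icc 0 r ×ˢ Ioi 0))
    (hwt : ContinuousOn (fun p : ℝ × ℝ => wt p.1 p.2) (Icc 0 r ×ˢ Ioi 0))
    (hd : ∀ s ∈ Icc 0 r, ∀ t, 0 < t → HasDerivAt (w s) (wt s t) t)
    (hM : ∀ s ∈ Icc 0 r, ∀ t, 0 < t → ‖w s t‖ ≤ M)
    (h0 : ∀ s ∈ Icc 0 r, Tendsto (w s) (nhdsWithin 0 (Ioi 0)) (nhds 0))
    (A : ℝ → ℂ) (hA : ∀ t, 0 < t → ∫ s in (0:ℝ)..r, wt s t = A t)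
    (hAc : ContinuousOn A (Ioi 0))
    (hM' : ∀ t, 0 < t → ‖A t‖ ≤ M') :
    ∫ t in Ioi (0:ℝ), (Real.exp (-(l * t)) : ℂ) * A t =
      l * ∫ s in (0:ℝ)..r, ∫ t in Ioi (0:ℝ), (Real.exp (-(l * t)) : ℂ) * w s t := by
  have hu : uIoc 0 r ⊆ Icc 0 r := by
    rw [uIoc_of_le hr.le]; exact Ioc_subset_Icc_self
  have slice : ∀ v : ℝ → ℝ → ℂ, ContinuousOn (fun p : ℝ × ℝ => v p.1 p.2) (Icc 0 r ×ˢ Ioi 0) →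
      ∀ t, 0 < t → ContinuousOn (fun s => v s t) (Icc 0 r) := by
    intro v hv t ht
    exact hv.comp (f := fun s : ℝ => (s, t)) (by fun_prop) (fun s hs => ⟨hs, ht⟩)
  have smeas : ∀ v : ℝ → ℝ → ℂ, ContinuousOn (fun p : ℝ × ℝ => v p.1 p.2) (Icc 0 r ×ˢ Ioi 0) →
      ∀ t, 0 < t → AEStronglyMeasurable (fun s => v s t) (volume.restrict (uIoc 0 r)) := by
    intro v hv t ht
    exact ((slice v hv t ht).mono hu).aestronglyMeasurable measurableSet_uIoc
  set B : ℝ → ℂ := fun t => if t ≤ 0 then 0 else ∫ s in (0:ℝ)..r, w s t with hB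
  have hBp : ∀ t, 0 < t → B t = ∫ s in (0:ℝ)..r, w s t := by
    intro t ht; simp [hB, not_le.2 ht]
  have hBev : ∀ t, 0 < t → B =ᶠ[nhds t] fun t => ∫ s in (0:ℝ)..r, w s t := by
    intro t ht
    filter_upwards [lt_mem_nhds ht] with z hz using hBp z hz
  have hBb : ∀ t, 0 < t → ‖B t‖ ≤ M * r := by
    intro t ht
    rw [hBp t ht]
    have := intervalIntegral.norm_integral_le_of_norm_le_const (a := 0) (b := r) (C := M)
      (f := fun s => w s t) (fun s hs => hM s (hu hs) t ht)
    simpa [abs_of_pos hr] using this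
  have hBd : ∀ t, 0 < t → HasDerivAt B (A t) t := by
    intro t ht
    rw [← hA t ht]
    refine HasDerivAt.congr_of_eventuallyEq ?_ (hBev t ht)
    have hcomp : IsCompact (Icc 0 r ×ˢ Icc (t / 2) (2 * t)) := isCompact_Icc.prod isCompact_Icc
    have hsub : Icc 0 r ×ˢ Icc (t / 2) (2 * t) ⊆ Icc 0 r ×ˢ Ioi 0 := by
      refine prod_mono_right (fun z hz => ?_)
      have := hz.1
      simp only [mem_Ioi]; linarith
    obtain ⟨C, hC⟩ := hcomp.exists_bound_of_continuousOn (hwt.mono hsub)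
    refine (intervalIntegral.hasDerivAt_integral_of_dominated_loc_of_deriv_le
      (F := fun t s => w s t) (F' := fun t s => wt s t) (bound := fun _ => C)
      (s := Icc (t / 2) (2 * t)) (Icc_mem_nhds (by linarith) (by linarith)) ?_ ?_ ?_ ?_ ?_ ?_).2
    · filter_upwards [lt_mem_nhds ht] with z hz using smeas w hw z hz
    · apply ContinuousOn.intervalIntegrable
      rw [uIcc_of_le hr.le]; exact slice w hw t ht
    · exact smeas wt hwt t ht
    · exact Eventually.of_forall (fun s hs z hz => hC (s, z) ⟨hu hs, hz⟩)
    · exact intervalIntegrable_const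
    · refine Eventually.of_forall (fun s hs z hz => hd s (hu hs) z ?_)
      have := hz.1
      linarith
  have hB0 : Tendsto B (nhdsWithin 0 (Ioi 0)) (nhds 0) := by
    have : Tendsto (fun t => ∫ s in (0:ℝ)..r, w s t) (nhdsWithin 0 (Ioi 0))
        (nhds (∫ s in (0:ℝ)..r, (0:ℂ))) := by
      refine intervalIntegral.tendsto_integral_filter_of_dominated_convergence (fun _ => M) ?_ ?_ ?_ ?_
      · filter_upwards [self_mem_nhdsWithin] with z hz using smeas w hw z hz
      · filter_upwards [self_mem_nhdsWithin] with z hz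
        exact Eventually.of_forall (fun s hs => hM s (hu hs) z hz)
      · exact intervalIntegrable_const
      · exact Eventually.of_forall (fun s hs => h0 s (hu hs))
    simp only [intervalIntegral.integral_zero] at this
    refine this.congr' ?_
    filter_upwards [self_mem_nhdsWithin] with z hz using (hBp z hz).symm
  have hBzero : B 0 = 0 := by simp [hB]
  have hBcw : ContinuousWithinAt B (Ici 0) 0 := by
    rw [← continuousWithinAt_Ioi_iff_Ici, ContinuousWithinAt, hBzero]; exact hB0
  have hBc : ContinuousOn B (Ioi 0) := fun t ht => (hBd t ht).continuousAt.continuousWithinAt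
  have iA := lapint l M' hl A hAc hM'
  have iB := lapint l (M * r) hl B hBc hBb
  have key := integral_Ioi_of_hasDerivAt_of_tendsto (a := 0) (m := 0)
    (f := fun t : ℝ => (Real.exp (-(l * t)) : ℂ) * B t)
    (f' := fun t : ℝ => (Real.exp (-(l * t)) : ℂ) * A t -
      (l : ℂ) * ((Real.exp (-(l * t)) : ℂ) * B t)) ?_ ?_ (iA.sub (iB.const_mul _)) ?_
  · rw [integral_sub iA (iB.const_mul _), integral_const_mul, hBzero, mul_zero, sub_zero,
      sub_eq_zero] at key
    rw [key]
    congr 1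
    rw [intervalIntegral_integral_swap]
    · apply setIntegral_congr_fun measurableSet_Ioi
      intro t ht
      simp only
      rw [intervalIntegral.integral_const_mul, hBp t ht]
    · have hmeas : AEStronglyMeasurable
          (Function.uncurry fun (s t : ℝ) => (Real.exp (-(l * t)) : ℂ) * w s t)
          ((volume.restrict (uIoc 0 r)).prod (volume.restrict (Ioi 0))) := by
        rw [Measure.prod_restrict]
        apply ContinuousOn.aestronglyMeasurable _ (measurableSet_uIoc.prod measurableSet_Ioi)
        refine ContinuousOn.mul (by fun_prop) ?_
        exact hw.mono (prod_mono_left hu)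
      refine Integrable.mono' (g := fun p : ℝ × ℝ => 1 * (Real.exp (-(l * p.2)) * M)) ?_ hmeas ?_
      · refine Integrable.mul_prod (f := fun _ : ℝ => (1:ℝ))
          (g := fun t => Real.exp (-(l * t)) * M) ?_ (expint l M hl)
        rw [uIoc_of_le hr.le]; exact integrable_const _
      · rw [Measure.prod_restrict]
        filter_upwards [ae_restrict_mem (measurableSet_uIoc.prod measurableSet_Ioi)] with p hp
        simp only [Function.uncurry, one_mul]
        rw [norm_mul, Complex.norm_real, Real.norm_eq_abs, abs_of_pos (Real.exp_pos _)]
        gcongr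
        exact hM _ (hu hp.1) _ hp.2
  · refine ContinuousWithinAt.mul (Continuous.continuousWithinAt (by fun_prop)) hBcw
  · intro t ht
    have e1 : HasDerivAt (fun t : ℝ => ((Real.exp (-(l * t)) : ℝ) : ℂ))
        ((Real.exp (-(l * t)) * (-(l * 1)) : ℝ) : ℂ) t :=
      HasDerivAt.ofReal_comp (((hasDerivAt_id t).const_mul l).neg.exp)
    refine (e1.mul (hBd t ht)).congr_deriv ?_
    push_cast; ring
  · have : Tendsto (fun t : ℝ => Real.exp (-(l * t)) * (M * r)) atTop (nhds 0) := by
      have h1 : Tendsto (fun t : ℝ => Real.exp (-(l * t))) atTop (nhds 0) :=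
        Real.tendsto_exp_neg_atTop_nhds_zero.comp (tendsto_id.const_mul_atTop hl)
      simpa using h1.mul_const (M * r)
    refine squeeze_zero_norm' ?_ this
    filter_upwards [eventually_gt_atTop 0] with t ht
    rw [norm_mul, Complex.norm_real, Real.norm_eq_abs, abs_of_pos (Real.exp_pos _)]
    gcongr
    exact hBb t ht

lemma lapA (u ux ut : ℝ → ℝ → ℂ) (m : ℝ → ℝ)
    (hm : ContinuousOn m (Ioi 0))
    (hu : ContinuousOn (fun p : ℝ × ℝ => u p.1 p.2) (Ioi 0 ×ˢ Ioi 0))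
    (hut : ContinuousOn (fun p : ℝ × ℝ => ut p.1 p.2) (Ioi 0 ×ˢ Ioi 0))
    (h1 : ∀ x t, 0 < x → 0 < t → HasDerivAt (fun z => u z t) (ux x t) x)
    (h2 : ∀ x t, 0 < x → 0 < t → HasDerivAt (fun z => ux z t) (m x * ut x t) x)
    (h3 : ∀ x t, 0 < x → 0 < t → HasDerivAt (fun z => u x z) (ut x t) t)
    (hb : ∀ a b, 0 < a → ∃ M, ∀ x t, a ≤ x → x ≤ b → 0 < t → ‖u x t‖ ≤ M)
    (hi : ∀ x, 0 < x → Tendsto (fun t => u x t) (nhdsWithin 0 (Ioi 0)) (nhds 0))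
    (l : ℝ) (hl : 0 < l) (U : ℝ → ℂ)
    (hU : ∀ x, 0 < x → U x = ∫ t in Ioi (0:ℝ), (Real.exp (-(l * t)) : ℂ) * u x t)
    (y r : ℝ) (hr : 0 < r) (hry : r < y) :
    U (y + r) + U (y - r) - 2 * U y =
      l * ∫ s in (0:ℝ)..r, ((r - s : ℝ) : ℂ) * (m (y + s) * U (y + s) + m (y - s) * U (y - s)) := by
  obtain ⟨M, hM⟩ := hb (y - r) (y + r) (by linarith)
  have hM0 : 0 ≤ M := le_trans (norm_nonneg _) (hM y 1 (by linarith) (by linarith) one_pos)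
  have hsl : ∀ x, 0 < x → ContinuousOn (u x) (Ioi 0) := fun x hx =>
    hu.comp (f := fun t : ℝ => (x, t)) (by fun_prop) (fun t ht => ⟨hx, ht⟩)
  have mp : ∀ s ∈ Icc 0 r, 0 < y + s := fun s hs => by linarith [hs.1]
  have mm : ∀ s ∈ Icc 0 r, 0 < y - s := fun s hs => by linarith [hs.2]
  have hmc : ContinuousOn (fun x => (m x : ℂ)) (Ioi 0) :=
    Complex.continuous_ofReal.comp_continuousOn hm
  have hmsub : Icc (y - r) (y + r) ⊆ Ioi 0 := fun z hz => by
    have := hz.1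
    simp only [mem_Ioi]; linarith
  obtain ⟨C, hC⟩ := isCompact_Icc.exists_bound_of_continuousOn (hm.mono hmsub)
  have hC0 : 0 ≤ C := le_trans (norm_nonneg _) (hC y ⟨by linarith, by linarith⟩)
  have int : ∀ x, y - r ≤ x → x ≤ y + r →
      IntegrableOn (fun t : ℝ => (Real.exp (-(l * t)) : ℂ) * u x t) (Ioi 0) := fun x ha hb' =>
    lapint l M hl (u x) (hsl x (by linarith)) (fun t ht => hM x t ha hb' ht)
  have wcont : ∀ v : ℝ → ℝ → ℂ, ContinuousOn (fun p : ℝ × ℝ => v p.1 p.2) (Ioi 0 ×ˢ Ioi 0) →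
      ContinuousOn (fun p : ℝ × ℝ => ((r - p.1 : ℝ) : ℂ) *
        (m (y + p.1) * v (y + p.1) p.2 + m (y - p.1) * v (y - p.1) p.2)) (Icc 0 r ×ˢ Ioi 0) := by
    intro v hv
    refine ContinuousOn.mul (by fun_prop) (ContinuousOn.add (ContinuousOn.mul ?_ ?_) (ContinuousOn.mul ?_ ?_))
    · exact hmc.comp (f := fun p : ℝ × ℝ => y + p.1) (by fun_prop) (fun p hp => mp _ hp.1)
    · exact hv.comp (f := fun p : ℝ × ℝ => (y + p.1, p.2)) (by fun_prop)
        (fun p hp => ⟨mp _ hp.1, hp.2⟩)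
    · exact hmc.comp (f := fun p : ℝ × ℝ => y - p.1) (by fun_prop) (fun p hp => mm _ hp.1)
    · exact hv.comp (f := fun p : ℝ × ℝ => (y - p.1, p.2)) (by fun_prop)
        (fun p hp => ⟨mm _ hp.1, hp.2⟩)
  have key := lapB
    (fun s t => ((r - s : ℝ) : ℂ) * (m (y + s) * u (y + s) t + m (y - s) * u (y - s) t))
    (fun s t => ((r - s : ℝ) : ℂ) * (m (y + s) * ut (y + s) t + m (y - s) * ut (y - s) t))
    r (r * (C * M + C * M)) (M + M + 2 * M) l hr hl (wcont u hu) (wcont ut hut) ?_ ?_ ?_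
    (fun t => u (y + r) t + u (y - r) t - 2 * u y t) ?_ ?_ ?_
  · have e1 : ∫ t in Ioi (0:ℝ), (Real.exp (-(l * t)) : ℂ) * (u (y + r) t + u (y - r) t - 2 * u y t)
        = U (y + r) + U (y - r) - 2 * U y := by
      rw [hU _ (by linarith), hU (y - r) (by linarith), hU y (by linarith)]
      have i1 := int (y + r) (by linarith) le_rfl
      have i2 := int (y - r) le_rfl (by linarith)
      have i3 := int y (by linarith) (by linarith)
      have i12 : IntegrableOn (fun t : ℝ => (Real.exp (-(l * t)) : ℂ) * u (y + r) t +
          (Real.exp (-(l * t)) : ℂ) * u (y - r) t) (Ioi 0) := i1.add i2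
      rw [← integral_const_mul, ← integral_add i1 i2, ← integral_sub i12 (i3.const_mul _)]
      congr 1; ext t; ring
    rw [← e1, key]
    congr 1
    apply intervalIntegral.integral_congr
    intro s hs
    rw [uIcc_of_le hr.le] at hs
    simp only
    rw [hU _ (mp s hs), hU _ (mm s hs), ← integral_const_mul, ← integral_const_mul,
      ← integral_add, ← integral_const_mul]
    · congr 1; ext t; ring
    · exact (int _ (by linarith [hs.1]) (by linarith [hs.2])).const_mul _
    · exact (int _ (by linarith [hs.2]) (by linarith [hs.1])).const_mul _
  · intro s hs t ht
    exact (((h3 _ t (mp s hs) ht).const_mul _).add ((h3 _ t (mm s hs) ht).const_mul _)).const_mul _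
  · intro s hs t ht
    have := hC (y + s) ⟨by linarith [hs.1], by linarith [hs.2]⟩
    have := hC (y - s) ⟨by linarith [hs.2], by linarith [hs.1]⟩
    have := hM (y + s) t (by linarith [hs.1]) (by linarith [hs.2]) ht
    have := hM (y - s) t (by linarith [hs.2]) (by linarith [hs.1]) ht
    rw [norm_mul, Complex.norm_real]
    have hrs : ‖r - s‖ ≤ r := by
      rw [Real.norm_eq_abs, abs_le]; constructor <;> linarith [hs.1, hs.2]
    gcongr
    refine (norm_add_le _ _).trans ?_
    rw [norm_mul, norm_mul, Complex.norm_real, Complex.norm_real]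
    gcongr
  · intro s hs
    have := (((hi _ (mp s hs)).const_mul (m (y + s) : ℂ)).add
      ((hi _ (mm s hs)).const_mul (m (y - s) : ℂ))).const_mul ((r - s : ℝ) : ℂ)
    simpa using this
  · intro t ht
    refine secdiff (fun x => u x t) (fun x => ux x t) (fun x => m x * ut x t) y r hr hry
      (fun x hx => h1 x t hx ht) (fun x hx => h2 x t hx ht) (hmc.mul ?_)
    exact hut.comp (f := fun x : ℝ => (x, t)) (by fun_prop) (fun x hx => ⟨hx, ht⟩)
  · exact ((hsl _ (by linarith)).add (hsl _ (by linarith))).sub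
      (continuousOn_const.mul (hsl _ (by linarith)))
  · intro t ht
    have a1 := hM (y + r) t (by linarith) (by linarith) ht
    have a2 := hM (y - r) t (by linarith) (by linarith) ht
    have a3 := hM y t (by linarith) (by linarith) ht
    refine (norm_sub_le _ _).trans (add_le_add ((norm_add_le _ _).trans (add_le_add a1 a2)) ?_)
    rw [norm_mul]; simpa using a3

lemma rexp_bdd (β d : ℝ) (hβ : 0 < β) (hd : 0 < d) :
    ∃ M, ∀ t, 0 < t → t ^ (-β) * Real.exp (-(d / t)) ≤ M := by
  have h := tendsto_rpow_mul_exp_neg_mul_atTop_nhds_zero β d hd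
  obtain ⟨Z, hZ⟩ := eventually_atTop.1 (h.eventually (gt_mem_nhds one_pos))
  refine ⟨max 1 (|Z| ^ β), fun t ht => ?_⟩
  have e : t ^ (-β) * Real.exp (-(d / t)) = (t⁻¹) ^ β * Real.exp (-d * t⁻¹) := by
    rw [Real.inv_rpow ht.le, Real.rpow_neg ht.le]; congr 2; ring
  rw [e]
  have hti : 0 < t⁻¹ := by positivity
  rcases le_total Z t⁻¹ with h1 | h1
  · exact le_max_of_le_left (hZ _ h1).le
  · apply le_max_of_le_right
    have : Real.exp (-d * t⁻¹) ≤ 1 := Real.exp_le_one_iff.2 (by nlinarith [mul_pos hd hti])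
    calc (t⁻¹) ^ β * Real.exp (-d * t⁻¹) ≤ (t⁻¹) ^ β * 1 := by gcongr
      _ ≤ |Z| ^ β := by
        rw [mul_one]
        exact Real.rpow_le_rpow hti.le (h1.trans (le_abs_self _)) hβ.le

lemma rexp_tendsto (β d : ℝ) (hd : 0 < d) :
    Tendsto (fun t : ℝ => t ^ (-β) * Real.exp (-(d / t))) (nhdsWithin 0 (Ioi 0)) (nhds 0) := by
  have h := (tendsto_rpow_mul_exp_neg_mul_atTop_nhds_zero β d hd).comp tendsto_inv_nhdsGT_zero
  refine h.congr' ?_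
  filter_upwards [self_mem_nhdsWithin] with t ht
  have ht' : 0 < t := ht
  simp only [Function.comp]
  rw [Real.inv_rpow ht'.le, Real.rpow_neg ht'.le]; congr 2; ring

lemma rexp_aux (β d : ℝ) (t : ℝ) (ht : t ∈ Ioi (0:ℝ)) :
    (|(-1:ℝ)| * t ^ ((-1:ℝ) - 1)) • ((t ^ (-1:ℝ)) ^ ((β - 1) - 1) * Real.exp (-(d * t ^ (-1:ℝ)))) =
      t ^ (-β) * Real.exp (-(d / t)) := by
  have ht' : 0 < t := ht
  rw [← Real.rpow_mul ht'.le, smul_eq_mul, ← mul_assoc, abs_neg, abs_one, one_mul,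
    ← Real.rpow_add ht', Real.rpow_neg_one]
  congr 2
  ring

lemma rexp_integrable (β d : ℝ) (hβ : 1 < β) (hd : 0 < d) :
    IntegrableOn (fun t : ℝ => t ^ (-β) * Real.exp (-(d / t))) (Ioi 0) := by
  have h : IntegrableOn (fun y : ℝ => y ^ ((β - 1) - 1) * Real.exp (-(d * y))) (Ioi 0) := by
    have := integrableOn_rpow_mul_exp_neg_mul_rpow (p := 1) (s := (β - 1) - 1) (b := d)
      (by linarith) one_pos hd
    simpa using this
  have h2 := (integrableOn_Ioi_comp_rpow_iff _ (show (-1:ℝ) ≠ 0 by norm_num)).2 h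
  exact h2.congr_fun (fun t ht => rexp_aux β d t ht) measurableSet_Ioi

lemma rexp_integral (β d : ℝ) (hβ : 1 < β) (hd : 0 < d) :
    ∫ t in Ioi (0:ℝ), t ^ (-β) * Real.exp (-(d / t)) = (1 / d) ^ (β - 1) * Real.Gamma (β - 1) := by
  rw [← Real.integral_rpow_mul_exp_neg_mul_Ioi (by linarith) hd,
    ← integral_comp_rpow_Ioi (fun y : ℝ => y ^ ((β - 1) - 1) * Real.exp (-(d * y)))
      (show (-1:ℝ) ≠ 0 by norm_num)]
  exact setIntegral_congr_fun measurableSet_Ioi (fun t ht => (rexp_aux β d t ht).symm)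

/-- The kernel. -/
noncomputable def Kf (C q β c x t : ℝ) : ℝ := C * (x * (t ^ (-β) * Real.exp (-((c * x ^ q) / t))))

lemma Kf_dt (C q β c x t : ℝ) (ht : 0 < t) :
    HasDerivAt (fun t => Kf C q β c x t) (Kf C q β c x t * (-(β / t) + c * x ^ q / t ^ 2)) t := by
  have h1 : HasDerivAt (fun t : ℝ => t ^ (-β)) ((-β) * t ^ (-β - 1)) t :=
    Real.hasDerivAt_rpow_const (Or.inl ht.ne')
  have h2 : HasDerivAt (fun t : ℝ => -((c * x ^ q) / t)) ((c * x ^ q) / t ^ 2) t := by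
    have := ((hasDerivAt_inv ht.ne').const_mul (c * x ^ q)).neg
    simp only [← div_eq_mul_inv] at this
    refine this.congr_deriv ?_
    field_simp
  refine (((h1.mul h2.exp).const_mul x).const_mul C).congr_deriv ?_
  rw [Real.rpow_sub_one ht.ne']
  unfold Kf
  field_simp

lemma Kf_dx (C q β c x t : ℝ) (hx : 0 < x) :
    HasDerivAt (fun x => Kf C q β c x t)
      (C * (t ^ (-β) * Real.exp (-((c * x ^ q) / t)) * (1 - c * q * x ^ q / t))) x := by
  have h1 : HasDerivAt (fun x : ℝ => x ^ q) (q * x ^ (q - 1)) x :=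
    Real.hasDerivAt_rpow_const (Or.inl hx.ne')
  have h2 : HasDerivAt (fun x : ℝ => t ^ (-β) * Real.exp (-((c * x ^ q) / t)))
      (t ^ (-β) * (Real.exp (-((c * x ^ q) / t)) * -(c * (q * x ^ (q - 1)) / t))) x :=
    (((h1.const_mul c).div_const t).neg.exp.const_mul (t ^ (-β)))
  refine (((hasDerivAt_id x).mul h2).const_mul C).congr_deriv ?_
  rw [Real.rpow_sub_one hx.ne']
  simp only [id]
  field_simp
  ring

lemma Kf_dxx (C q β c x t : ℝ) (hx : 0 < x) (ht : 0 < t) (hc : c * q ^ 2 = 1)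
    (hβ : β = c * q + 1) :
    HasDerivAt (fun x => C * (t ^ (-β) * Real.exp (-((c * x ^ q) / t)) * (1 - c * q * x ^ q / t)))
      (x ^ (q - 2) * (Kf C q β c x t * (-(β / t) + c * x ^ q / t ^ 2))) x := by
  have h1 : HasDerivAt (fun x : ℝ => x ^ q) (q * x ^ (q - 1)) x :=
    Real.hasDerivAt_rpow_const (Or.inl hx.ne')
  have h2 : HasDerivAt (fun x : ℝ => t ^ (-β) * Real.exp (-((c * x ^ q) / t)))
      (t ^ (-β) * (Real.exp (-((c * x ^ q) / t)) * -(c * (q * x ^ (q - 1)) / t))) x :=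
    (((h1.const_mul c).div_const t).neg.exp.const_mul (t ^ (-β)))
  have h3 := ((h1.const_mul (c * q)).div_const t).const_sub 1
  refine ((h2.mul h3).const_mul C).congr_deriv ?_
  have e1 : x ^ (q - 1) = x ^ (q - 2) * x := by
    rw [← Real.rpow_add_one hx.ne']; congr 1; ring
  have e2 : x ^ q = x ^ (q - 2) * x ^ 2 := by
    rw [← Real.rpow_natCast, ← Real.rpow_add hx]; congr 1; norm_num
  unfold Kf
  rw [e1]
  set T := t ^ (-β)
  set E := Real.exp (-((c * x ^ q) / t))
  rw [e2]
  set X := x ^ (q - 2)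
  rw [hβ]
  have ht0 := ht.ne'
  field_simp
  linear_combination (C * T * E * X * (-t + c * X * x ^ 2)) * hc

lemma Kf_cont (C q β c : ℝ) :
    ContinuousOn (fun p : ℝ × ℝ => Kf C q β c p.1 p.2) (Ioi 0 ×ˢ Ioi 0) := by
  intro p hp
  have h1 : p.1 ≠ 0 := (ne_of_gt hp.1)
  have h2 : p.2 ≠ 0 := (ne_of_gt hp.2)
  apply ContinuousAt.continuousWithinAt
  unfold Kf
  have a1 : ContinuousAt (fun p : ℝ × ℝ => p.2 ^ (-β)) p :=
    (Real.continuousAt_rpow_const _ _ (Or.inl h2)).comp continuousAt_snd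
  have a2 : ContinuousAt (fun p : ℝ × ℝ => p.1 ^ q) p :=
    (Real.continuousAt_rpow_const _ _ (Or.inl h1)).comp continuousAt_fst
  exact continuousAt_const.mul (continuousAt_fst.mul (a1.mul
    (Real.continuous_exp.continuousAt.comp ((continuousAt_const.mul a2).div continuousAt_snd h2).neg)))

lemma Kf_nonneg (C q β c x t : ℝ) (hC : 0 < C) (hx : 0 < x) (ht : 0 < t) : 0 ≤ Kf C q β c x t := by
  unfold Kf; positivity

lemma Kf_bdd (C q β c : ℝ) (hC : 0 < C) (hq : 0 < q) (hβ : 0 < β) (hc : 0 < c) (a b : ℝ) (ha : 0 < a) :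
    ∃ M, ∀ x t, a ≤ x → x ≤ b → 0 < t → Kf C q β c x t ≤ M := by
  obtain ⟨M, hM⟩ := rexp_bdd β (c * a ^ q) hβ (by positivity)
  refine ⟨C * (|b| * M), fun x t h1 h2 ht => ?_⟩
  have hx : 0 < x := ha.trans_le h1
  unfold Kf
  have : t ^ (-β) * Real.exp (-((c * x ^ q) / t)) ≤ M := by
    refine le_trans ?_ (hM t ht)
    gcongr
  gcongr
  exact h2.trans (le_abs_self _)

lemma Kf_init (C q β c x : ℝ) (hc : 0 < c) (hx : 0 < x) :
    Tendsto (fun t => Kf C q β c x t) (nhdsWithin 0 (Ioi 0)) (nhds 0) := by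
  have := ((rexp_tendsto β (c * x ^ q) (by positivity)).const_mul x).const_mul C
  simpa [Kf] using this

lemma Kf_integrable (C q β c x : ℝ) (hβ : 1 < β) (hc : 0 < c) (hx : 0 < x) :
    IntegrableOn (fun t => Kf C q β c x t) (Ioi 0) :=
  ((rexp_integrable β (c * x ^ q) hβ (by positivity)).const_mul x).const_mul C

/-- Laplace transform of the kernel. -/
noncomputable def Phi (C q β c l x : ℝ) : ℝ :=
  ∫ s in Ioi (0:ℝ), Real.exp (-(l * x ^ q * s)) * Kf C q β c 1 s

lemma Kf_lap (C q β c l x : ℝ) (hq : 0 < q) (hqβ : q * (β - 1) = 1) (hx : 0 < x) :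
    ∫ t in Ioi (0:ℝ), Real.exp (-(l * t)) * Kf C q β c x t = Phi C q β c l x := by
  set b := x ^ q with hb
  have hb0 : 0 < b := by positivity
  have h := integral_comp_mul_left_Ioi' (fun t => Real.exp (-(l * t)) * Kf C q β c x t) 0 hb0
  rw [mul_zero] at h
  rw [← h, Phi, ← integral_smul]
  apply setIntegral_congr_fun measurableSet_Ioi
  intro s hs
  have hs' : 0 < s := hs
  have e1 : x = b ^ (β - 1) := by
    rw [hb, ← Real.rpow_mul hx.le, hqβ, Real.rpow_one]
  have e2 : b * (x * (b * s) ^ (-β)) = s ^ (-β) := by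
    rw [Real.mul_rpow hb0.le hs'.le]
    nth_rw 1 [e1]
    have : b * (b ^ (β - 1) * (b ^ (-β) * s ^ (-β))) = (b ^ (1:ℝ) * b ^ (β - 1) * b ^ (-β)) * s ^ (-β) := by
      rw [Real.rpow_one]; ring
    rw [this, ← Real.rpow_add hb0, ← Real.rpow_add hb0]
    simp
  have e3 : c * b / (b * s) = c / s := by field_simp
  simp only [Kf, smul_eq_mul, Real.one_rpow, mul_one, one_mul, ← hb, e3]
  rw [← e2]
  rw [show l * (b * s) = l * b * s by ring]
  ring

lemma exp_Kf_bd (C q β c l x : ℝ) (hC : 0 < C) (hl : 0 < l) (hx : 0 ≤ x) (s : ℝ) (hs : 0 < s) :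
    ‖Real.exp (-(l * x ^ q * s)) * Kf C q β c 1 s‖ ≤ Kf C q β c 1 s := by
  have h0 := Kf_nonneg C q β c 1 s hC one_pos hs
  rw [norm_mul, Real.norm_eq_abs, Real.norm_eq_abs, abs_of_pos (Real.exp_pos _), abs_of_nonneg h0]
  apply mul_le_of_le_one_left h0
  rw [Real.exp_le_one_iff]
  have : 0 ≤ l * x ^ q * s := by positivity
  linarith

lemma Phi_zero (C q β c l : ℝ) (hq : 0 < q) (hβ : 1 < β) (hc : 0 < c)
    (hn : C * ((1 / c) ^ (β - 1) * Real.Gamma (β - 1)) = 1) : Phi C q β c l 0 = 1 := by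
  simp only [Phi, Kf, Real.zero_rpow hq.ne', Real.one_rpow, mul_zero, zero_mul, neg_zero,
    Real.exp_zero, one_mul, mul_one]
  rw [integral_const_mul, rexp_integral β c hβ hc, hn]

lemma Phi_cont (C q β c l : ℝ) (hC : 0 < C) (hq : 0 < q) (hβ : 1 < β) (hc : 0 < c) (hl : 0 < l) :
    ContinuousOn (Phi C q β c l) (Ici 0) := by
  unfold Phi
  refine continuousOn_of_dominated (bound := fun s => Kf C q β c 1 s) ?_ ?_
    (Kf_integrable C q β c 1 hβ hc one_pos) ?_
  · intro x hx
    exact AEStronglyMeasurable.mul (Continuous.aestronglyMeasurable (by fun_prop))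
      (Kf_integrable C q β c 1 hβ hc one_pos).aestronglyMeasurable
  · intro x hx
    filter_upwards [ae_restrict_mem measurableSet_Ioi] with s hs
    exact exp_Kf_bd C q β c l x hC hl hx s hs
  · refine Eventually.of_forall (fun s => ?_)
    have := Real.continuous_rpow_const hq.le
    fun_prop

lemma Phi_bd (C q β c l x : ℝ) (hC : 0 < C) (hβ : 1 < β) (hc : 0 < c) (hl : 0 < l)
    (hx : 0 ≤ x) :
    ‖Phi C q β c l x‖ ≤ ∫ s in Ioi (0:ℝ), Kf C q β c 1 s := by
  apply norm_integral_le_of_norm_le (Kf_integrable C q β c 1 hβ hc one_pos)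
  filter_upwards [ae_restrict_mem measurableSet_Ioi] with s hs
  exact exp_Kf_bd C q β c l x hC hl hx s hs

/-- Laplace transform identity for the solution. -/
lemma lap_sol (C q β c : ℝ) (hC : 0 < C) (hq : 0 < q) (hc : 0 < c)
    (hcq : c * q ^ 2 = 1) (hβc : β = c * q + 1)
    (hn : C * ((1 / c) ^ (β - 1) * Real.Gamma (β - 1)) = 1)
    (u ux ut : ℝ → ℝ → ℂ)
    (hub : ∃ M : ℝ, ∀ x t : ℝ, 0 ≤ x → 0 < t → ‖u x t‖ ≤ M)
    (huc : ContinuousOn (fun p : ℝ × ℝ => u p.1 p.2) (Ici 0 ×ˢ Ioi 0))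
    (hut : ContinuousOn (fun p : ℝ × ℝ => ut p.1 p.2) (Ioi 0 ×ˢ Ioi 0))
    (h1 : ∀ x t, 0 < x → 0 < t → HasDerivAt (fun z => u z t) (ux x t) x)
    (h2 : ∀ x t, 0 < x → 0 < t →
      HasDerivAt (fun z => ux z t) (((x ^ (q - 2) : ℝ) : ℂ) * ut x t) x)
    (h3 : ∀ x t, 0 < x → 0 < t → HasDerivAt (fun z => u x z) (ut x t) t)
    (hi : ∀ x, 0 < x → Tendsto (fun t => u x t) (nhdsWithin 0 (Ioi 0)) (nhds 0))
    (l : ℝ) (hl : 0 < l) (x : ℝ) (hx : 0 ≤ x) :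
    ∫ t in Ioi (0:ℝ), (Real.exp (-(l * t)) : ℂ) * u x t =
      (Phi C q β c l x : ℂ) * ∫ t in Ioi (0:ℝ), (Real.exp (-(l * t)) : ℂ) * u 0 t := by
  have hβ : 1 < β := by rw [hβc]; have := mul_pos hc hq; linarith
  have hqβ : q * (β - 1) = 1 := by rw [hβc, ← hcq]; ring
  obtain ⟨M, hM⟩ := hub
  set U : ℝ → ℂ := fun x => ∫ t in Ioi (0:ℝ), (Real.exp (-(l * t)) : ℂ) * u x t with hU
  have hsl : ∀ x, 0 ≤ x → ContinuousOn (u x) (Ioi 0) := fun x hx =>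
    huc.comp (f := fun t : ℝ => (x, t)) (by fun_prop) (fun t ht => ⟨hx, ht⟩)
  have nb : ∀ x t, 0 ≤ x → 0 < t → ‖(Real.exp (-(l * t)) : ℂ) * u x t‖ ≤ Real.exp (-(l * t)) * M := by
    intro x t hx ht
    rw [norm_mul, Complex.norm_real, Real.norm_eq_abs, abs_of_pos (Real.exp_pos _)]
    gcongr
    exact hM x t hx ht
  have hUc : ContinuousOn U (Ici 0) := by
    refine continuousOn_of_dominated (bound := fun t => Real.exp (-(l * t)) * M) ?_ ?_ (expint l M hl) ?_
    · intro x hx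
      exact (lapint l M hl (u x) (hsl x hx) (fun t ht => hM x t hx ht)).aestronglyMeasurable
    · intro x hx
      filter_upwards [ae_restrict_mem measurableSet_Ioi] with t ht
      exact nb x t hx ht
    · filter_upwards [ae_restrict_mem measurableSet_Ioi] with t ht
      exact continuousOn_const.mul
        (huc.comp (f := fun x : ℝ => (x, t)) (by fun_prop) (fun x hx => ⟨hx, ht⟩))
  have hUb : ∀ x, 0 ≤ x → ‖U x‖ ≤ ∫ t in Ioi (0:ℝ), Real.exp (-(l * t)) * M := by
    intro x hx
    apply norm_integral_le_of_norm_le (expint l M hl)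
    filter_upwards [ae_restrict_mem measurableSet_Ioi] with t ht
    exact nb x t hx ht
  have hm : ContinuousOn (fun x : ℝ => x ^ (q - 2)) (Ioi 0) :=
    fun x hx => (Real.continuousAt_rpow_const _ _ (Or.inl (ne_of_gt hx))).continuousWithinAt
  have kU := lapA u ux ut (fun x => x ^ (q - 2)) hm
    (huc.mono (prod_mono_left Ioi_subset_Ici_self)) hut h1 h2 h3
    (fun a b ha => ⟨M, fun x t h1 _ ht => hM x t (ha.le.trans h1) ht⟩) hi l hl U (fun x hx => rfl)
  have kP := lapA (fun x t => (Kf C q β c x t : ℂ))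
    (fun x t => ((C * (t ^ (-β) * Real.exp (-((c * x ^ q) / t)) * (1 - c * q * x ^ q / t)) : ℝ) : ℂ))
    (fun x t => ((Kf C q β c x t * (-(β / t) + c * x ^ q / t ^ 2) : ℝ) : ℂ))
    (fun x => x ^ (q - 2)) hm
    (Complex.continuous_ofReal.comp_continuousOn (Kf_cont C q β c))
    (Complex.continuous_ofReal.comp_continuousOn ((Kf_cont C q β c).mul (by
      intro p hp
      have h1 : p.1 ≠ 0 := (ne_of_gt hp.1)
      have h2 : p.2 ≠ 0 := (ne_of_gt hp.2)
      apply ContinuousAt.continuousWithinAt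
      have a2 : ContinuousAt (fun p : ℝ × ℝ => p.1 ^ q) p :=
        (Real.continuousAt_rpow_const _ _ (Or.inl h1)).comp continuousAt_fst
      exact ((continuousAt_const.div continuousAt_snd h2).neg).add
        ((continuousAt_const.mul a2).div (continuousAt_snd.pow 2) (pow_ne_zero 2 h2)))))
    (fun x t hx ht => (Kf_dx C q β c x t hx).ofReal_comp)
    (fun x t hx ht => by
      have := (Kf_dxx C q β c x t hx ht hcq hβc).ofReal_comp
      rw [Complex.ofReal_mul] at this
      exact this)
    (fun x t hx ht => (Kf_dt C q β c x t ht).ofReal_comp)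
    (fun a b ha => by
      obtain ⟨M, hM⟩ := Kf_bdd C q β c hC hq (by linarith) hc a b ha
      refine ⟨M, fun x t h1 h2 ht => ?_⟩
      rw [Complex.norm_real, Real.norm_eq_abs,
        abs_of_nonneg (Kf_nonneg C q β c x t hC (ha.trans_le h1) ht)]
      exact hM x t h1 h2 ht)
    (fun x hx => by
      have := (Complex.continuous_ofReal.tendsto 0).comp (Kf_init C q β c x hc hx)
      rw [Complex.ofReal_zero] at this
      exact this) l hl (fun x => (Phi C q β c l x : ℂ))
    (fun x hx => by
      rw [← Kf_lap C q β c l x hq hqβ hx, ← integral_complex_ofReal]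
      simp)
  set D : ℝ → ℂ := fun x => U x - Phi C q β c l x * U 0 with hD
  have hPc : ContinuousOn (fun x => (Phi C q β c l x : ℂ)) (Ici 0) :=
    Complex.continuous_ofReal.comp_continuousOn (Phi_cont C q β c l hC hq hβ hc hl)
  have hDc : ContinuousOn D (Ici 0) := hUc.sub (hPc.mul continuousOn_const)
  have hmC : ContinuousOn (fun x : ℝ => ((x ^ (q - 2) : ℝ) : ℂ)) (Ioi 0) :=
    Complex.continuous_ofReal.comp_continuousOn hm
  have hIntg : ∀ V : ℝ → ℂ, ContinuousOn V (Ici 0) → ∀ y r, 0 < r → r < y →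
      IntervalIntegrable (fun s : ℝ => ((r - s : ℝ) : ℂ) * (((y + s) ^ (q - 2) : ℝ) * V (y + s) +
        ((y - s) ^ (q - 2) : ℝ) * V (y - s))) volume 0 r := by
    intro V hV y r hr hry
    apply ContinuousOn.intervalIntegrable
    rw [uIcc_of_le hr.le]
    have hV' := hV.mono Ioi_subset_Ici_self
    have mp : MapsTo (fun s => y + s) (Icc 0 r) (Ioi 0) := fun s hs => by
      simp only [mem_Ioi]; linarith [hs.1]
    have mm : MapsTo (fun s => y - s) (Icc 0 r) (Ioi 0) := fun s hs => by
      simp only [mem_Ioi]; linarith [hs.2]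
    apply ContinuousOn.mul (by fun_prop)
    exact ((hmC.comp (by fun_prop) mp).mul (hV'.comp (by fun_prop) mp)).add
      ((hmC.comp (by fun_prop) mm).mul (hV'.comp (by fun_prop) mm))
  have hDid : ∀ y r, 0 < r → r < y → D (y + r) + D (y - r) - 2 * D y =
      l * ∫ s in (0:ℝ)..r, ((r - s : ℝ) : ℂ) * (((y + s) ^ (q - 2) : ℝ) * D (y + s) +
        ((y - s) ^ (q - 2) : ℝ) * D (y - s)) := by
    intro y r hr hry
    have a1 := kU y r hr hry
    have a2 := kP y r hr hry
    have a3 : ∫ s in (0:ℝ)..r, ((r - s : ℝ) : ℂ) * (((y + s) ^ (q - 2) : ℝ) * D (y + s) +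
        ((y - s) ^ (q - 2) : ℝ) * D (y - s)) =
        (∫ s in (0:ℝ)..r, ((r - s : ℝ) : ℂ) * (((y + s) ^ (q - 2) : ℝ) * U (y + s) +
        ((y - s) ^ (q - 2) : ℝ) * U (y - s))) - (∫ s in (0:ℝ)..r, ((r - s : ℝ) : ℂ) *
          (((y + s) ^ (q - 2) : ℝ) * (Phi C q β c l (y + s) : ℂ) +
        ((y - s) ^ (q - 2) : ℝ) * (Phi C q β c l (y - s) : ℂ))) * U 0 := by
      rw [← intervalIntegral.integral_mul_const, ← intervalIntegral.integral_sub
        (hIntg U hUc y r hr hry) ((hIntg _ hPc y r hr hry).mul_const _)]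
      congr 1; ext s; simp only [hD]; ring
    rw [a3]
    simp only [hD]
    linear_combination a1 - U 0 * a2
  have hD0 : D 0 = 0 := by simp [hD, Phi_zero C q β c l hq hβ hc hn]
  have hDb : ∀ x, 0 ≤ x → ‖D x‖ ≤ (∫ t in Ioi (0:ℝ), Real.exp (-(l * t)) * M) +
      (∫ s in Ioi (0:ℝ), Kf C q β c 1 s) * ‖U 0‖ := by
    intro x hx
    refine (norm_sub_le _ _).trans (add_le_add (hUb x hx) ?_)
    rw [norm_mul, Complex.norm_real]
    gcongr
    exact Phi_bd C q β c l x hC hβ hc hl hx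
  have hE := maxprin (fun z => (star (D x) * D z).re) (fun x => x ^ (q - 2)) l hl ?_ ?_ hm ?_ ?_ ?_ x hx
  · have h0 : D x = 0 := by
      have : (star (D x) * D x).re = ‖D x‖ ^ 2 := by
        rw [← Complex.normSq_eq_norm_sq, Complex.star_def, ← Complex.normSq_eq_conj_mul_self,
          Complex.ofReal_re]
      simp only [this] at hE
      have : ‖D x‖ = 0 := by nlinarith [norm_nonneg (D x)]
      exact norm_eq_zero.1 this
    exact sub_eq_zero.1 h0
  · exact Complex.continuous_re.comp_continuousOn (continuousOn_const.mul hDc)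
  · simp [hD0]
  · intro z hz; positivity
  · refine ⟨‖D x‖ * ((∫ t in Ioi (0:ℝ), Real.exp (-(l * t)) * M) +
      (∫ s in Ioi (0:ℝ), Kf C q β c 1 s) * ‖U 0‖), fun z hz => ?_⟩
    refine (Complex.re_le_norm _).trans ?_
    rw [norm_mul, norm_star]
    gcongr
    exact hDb z hz
  · intro y r hr hry
    have a := congrArg (fun z => (star (D x) * z).re) (hDid y r hr hry)
    have b1 : (star (D x) * (D (y + r) + D (y - r) - 2 * D y)).re =
        (star (D x) * D (y + r)).re + (star (D x) * D (y - r)).re - 2 * (star (D x) * D y).re := by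
      simp; ring
    rw [b1] at a
    rw [a, mul_left_comm, Complex.re_ofReal_mul]
    congr 1
    rw [← intervalIntegral.integral_const_mul]
    have := Complex.reCLM.intervalIntegral_comp_comm ((hIntg D hDc y r hr hry).const_mul (star (D x)))
    refine this.symm.trans ?_
    apply intervalIntegral.integral_congr
    intro s _
    have e : star (D x) * (((r - s : ℝ) : ℂ) * (((y + s) ^ (q - 2) : ℝ) * D (y + s) +
        ((y - s) ^ (q - 2) : ℝ) * D (y - s))) = ((r - s : ℝ) : ℂ) * (
        (((y + s) ^ (q - 2) : ℝ) : ℂ) * (star (D x) * D (y + s)) +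
        (((y - s) ^ (q - 2) : ℝ) : ℂ) * (star (D x) * D (y - s))) := by ring
    change (star (D x) * (((r - s : ℝ) : ℂ) * (((y + s) ^ (q - 2) : ℝ) * D (y + s) +
        ((y - s) ^ (q - 2) : ℝ) * D (y - s)))).re = _
    rw [e, Complex.re_ofReal_mul, Complex.add_re, Complex.re_ofReal_mul, Complex.re_ofReal_mul]

lemma conv_lap (k f : ℝ → ℂ) (Mk Mf : ℝ) (hkc : ContinuousOn k (Ioi 0))
    (hkb : ∀ t, 0 < t → ‖k t‖ ≤ Mk) (hfc : Continuous f) (hfb : ∀ t, ‖f t‖ ≤ Mf)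
    (l : ℝ) (hl : 0 < l) :
    ∫ t in Ioi (0:ℝ), (Real.exp (-(l * t)) : ℂ) * (∫ τ in (0:ℝ)..t, k (t - τ) * f τ) =
      (∫ t in Ioi (0:ℝ), (Real.exp (-(l * t)) : ℂ) * k t) *
        ∫ t in Ioi (0:ℝ), (Real.exp (-(l * t)) : ℂ) * f t := by
  have h := integral_posConvolution (lapint l Mf hl f hfc.continuousOn (fun t _ => hfb t))
    (lapint l Mk hl k hkc hkb) (ContinuousLinearMap.mul ℝ ℂ)
  simp only [ContinuousLinearMap.mul_apply'] at h
  rw [mul_comm, ← h]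
  apply setIntegral_congr_fun measurableSet_Ioi
  intro t ht
  simp only
  rw [← intervalIntegral.integral_const_mul]
  congr 1; ext τ
  have : Real.exp (-(l * t)) = Real.exp (-(l * τ)) * Real.exp (-(l * (t - τ))) := by
    rw [← Real.exp_add]; congr 1; ring
  rw [this]; push_cast; ring

lemma conv_eq (k f : ℝ → ℂ) (hf0 : ∀ t, t ≤ 0 → f t = 0) (t : ℝ) (ht : 0 < t) :
    ∫ τ in (0:ℝ)..t, k (t - τ) * f τ = ∫ s in Ioi (0:ℝ), k s * f (t - s) := by
  have h := intervalIntegral.integral_comp_sub_left (a := 0) (b := t) (fun s => k s * f (t - s)) t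
  simp only [sub_sub_cancel, sub_self, sub_zero] at h
  rw [h, intervalIntegral.integral_of_le ht.le]
  symm
  apply setIntegral_eq_of_subset_of_forall_sdiff_eq_zero measurableSet_Ioi Ioc_subset_Ioi_self
  intro s hs
  have : t < s := by
    by_contra hh
    exact hs.2 ⟨hs.1, not_lt.1 hh⟩
  rw [hf0 _ (by linarith), mul_zero]

lemma conv_cont (k f : ℝ → ℂ) (Mf : ℝ) (hk : IntegrableOn k (Ioi 0)) (hfc : Continuous f)
    (hfb : ∀ t, ‖f t‖ ≤ Mf) :
    Continuous (fun t : ℝ => ∫ s in Ioi (0:ℝ), k s * f (t - s)) ∧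
      ∀ t : ℝ, ‖∫ s in Ioi (0:ℝ), k s * f (t - s)‖ ≤ ∫ s in Ioi (0:ℝ), ‖k s‖ * Mf := by
  have nb : ∀ t s : ℝ, ‖k s * f (t - s)‖ ≤ ‖k s‖ * Mf := by
    intro t s
    rw [norm_mul]; gcongr; exact hfb _
  constructor
  · refine continuous_of_dominated (bound := fun s => ‖k s‖ * Mf) ?_ ?_ (hk.norm.mul_const _) ?_
    · intro t
      exact hk.aestronglyMeasurable.mul (Continuous.aestronglyMeasurable (by fun_prop))
    · exact fun t => Eventually.of_forall (nb t)
    · exact Eventually.of_forall (fun s => by fun_prop)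
  · intro t
    exact norm_integral_le_of_norm_le (hk.norm.mul_const _) (Eventually.of_forall (nb t))

theorem stmt9 (α : ℝ) (hα : 0 < α)
    (g : ℝ → ℂ) (hgc : ContinuousOn g (Set.Ici 0))
    (hgb : ∃ M : ℝ, ∀ t : ℝ, 0 ≤ t → ‖((t ^ α : ℝ) : ℂ) * g t‖ ≤ M)
    (u : ℝ → ℝ → ℂ)
    (hub : ∃ M : ℝ, ∀ x t : ℝ, 0 ≤ x → 0 < t → ‖u x t‖ ≤ M)
    (huc : ContinuousOn (fun p : ℝ × ℝ => u p.1 p.2) (Set.Ici 0 ×ˢ Set.Ioi 0))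
    (hu2 : ContDiffOn ℝ 2 (fun p : ℝ × ℝ => u p.1 p.2) (Set.Ioi 0 ×ˢ Set.Ioi 0))
    (hpde : ∀ x t : ℝ, 0 < x → 0 < t →
      deriv (fun s => u x s) t =
        (x ^ (2 * (α - 1) / α) : ℝ) * iteratedDeriv 2 (fun y => u y t) x)
    (hbdry : ∀ t : ℝ, 0 < t → u 0 t = ((t ^ α : ℝ) : ℂ) * g t)
    (hinit : ∀ x : ℝ, 0 < x →
      Tendsto (fun t => u x t) (nhdsWithin 0 (Set.Ioi 0)) (nhds 0))
    (hinf : ∀ t : ℝ, 0 < t → Tendsto (fun x => u x t) atTop (nhds 0)) :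
    ∀ x t : ℝ, 0 < x → 0 < t → u x t = ((t ^ α : ℝ) : ℂ) * Lt α t g x := by
  intro x t hx ht
  set C := (α / 2) ^ α / Real.Gamma (α / 2) with hCdef
  set q := 2 / α with hqdef
  set β := α / 2 + 1 with hβdef
  set c := α ^ 2 / 4 with hcdef
  have hG : 0 < Real.Gamma (α / 2) := Real.Gamma_pos_of_pos (by positivity)
  have hC : 0 < C := by positivity
  have hq : 0 < q := by positivity
  have hc : 0 < c := by positivity
  have hcq : c * q ^ 2 = 1 := by rw [hcdef, hqdef]; field_simp; norm_num
  have hβc : β = c * q + 1 := by rw [hcdef, hqdef, hβdef]; field_simp; ring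
  have hβ : 1 < β := by rw [hβdef]; linarith
  have hqβ : q * (β - 1) = 1 := by rw [hβc, ← hcq]; ring
  have hn : C * ((1 / c) ^ (β - 1) * Real.Gamma (β - 1)) = 1 := by
    have e1 : β - 1 = α / 2 := by rw [hβdef]; ring
    have e2 : (1 / c) ^ (α / 2) = ((α / 2) ^ α)⁻¹ := by
      have : c = (α / 2) ^ (2:ℝ) := by rw [hcdef, Real.rpow_two]; ring
      rw [one_div, Real.inv_rpow hc.le, this, ← Real.rpow_mul (by positivity)]
      congr 2; ring
    rw [e1, e2, hCdef]
    have : (α / 2) ^ α ≠ 0 := by positivity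
    field_simp
  -- boundary function
  set f : ℝ → ℂ := fun t => (((max t 0) ^ α : ℝ) : ℂ) * g (max t 0) with hf
  have hfc : Continuous f := by
    refine Continuous.mul ?_ ?_
    · exact Complex.continuous_ofReal.comp
        ((Real.continuous_rpow_const hα.le).comp (continuous_id.max continuous_const))
    · exact hgc.comp_continuous (continuous_id.max continuous_const) (fun t => mem_Ici.2 (le_max_right _ _))
  obtain ⟨Mf, hMf⟩ := hgb
  have hfb : ∀ t, ‖f t‖ ≤ Mf := fun t => hMf _ (le_max_right _ _)
  have hf0 : ∀ t, t ≤ 0 → f t = 0 := by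
    intro t ht; simp [hf, max_eq_right ht, Real.zero_rpow hα.ne']
  have hfp : ∀ t, 0 < t → f t = ((t ^ α : ℝ) : ℂ) * g t := by
    intro t ht; simp [hf, max_eq_left ht.le]
  -- regularity
  have hopen : IsOpen (Ioi (0:ℝ) ×ˢ Ioi (0:ℝ)) := isOpen_Ioi.prod isOpen_Ioi
  have hfd : ∀ x t, 0 < x → 0 < t →
      DifferentiableAt ℝ (fun p : ℝ × ℝ => u p.1 p.2) (x, t) := fun x t hx ht =>
    (hu2.differentiableOn (by norm_num)).differentiableAt (hopen.mem_nhds ⟨hx, ht⟩)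
  have h3' : ∀ x t, 0 < x → 0 < t → HasDerivAt (fun z => u x z)
      (fderiv ℝ (fun p : ℝ × ℝ => u p.1 p.2) (x, t) (0, 1)) t := by
    intro x t hx ht
    have := (hfd x t hx ht).hasFDerivAt.comp_hasDerivAt t
      ((hasDerivAt_const t x).prodMk (hasDerivAt_id t))
    exact this
  have hx2 : ∀ t, 0 < t → ContDiffOn ℝ 2 (fun z => u z t) (Ioi 0) := by
    intro t ht
    exact hu2.comp (f := fun z : ℝ => (z, t)) (by fun_prop) (fun z hz => ⟨hz, ht⟩)
  have hlap := lap_sol C q β c hC hq hc hcq hβc hn u (fun x t => deriv (fun z => u z t) x)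
    (fun x t => deriv (fun z => u x z) t) hub huc ?_ ?_ ?_ ?_ hinit
  · -- kernel
    set k : ℝ → ℂ := fun s => (Kf C q β c x s : ℂ) with hk
    have hkc : ContinuousOn k (Ioi 0) := Complex.continuous_ofReal.comp_continuousOn
      ((Kf_cont C q β c).comp (f := fun t : ℝ => (x, t)) (by fun_prop) (fun t ht => ⟨hx, ht⟩))
    obtain ⟨Mk, hMk⟩ := Kf_bdd C q β c hC hq (by linarith) hc x x hx
    have hkb : ∀ t, 0 < t → ‖k t‖ ≤ Mk := by
      intro t ht
      rw [hk, Complex.norm_real, Real.norm_eq_abs, abs_of_nonneg (Kf_nonneg C q β c x t hC hx ht)]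
      exact hMk x t le_rfl le_rfl ht
    have hki : IntegrableOn k (Ioi 0) := (Kf_integrable C q β c x hβ hc hx).ofReal
    set v : ℝ → ℂ := fun t => ∫ s in Ioi (0:ℝ), k s * f (t - s) with hv
    obtain ⟨hvc, hvb⟩ := conv_cont k f Mf hki hfc hfb
    obtain ⟨M, hM⟩ := hub
    have huxc : ContinuousOn (u x) (Ioi 0) :=
      huc.comp (f := fun t : ℝ => (x, t)) (by fun_prop) (fun t ht => ⟨hx.le, ht⟩)
    have hzero := lerch (fun t => u x t - v t) (M + ∫ s in Ioi (0:ℝ), ‖k s‖ * Mf)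
      (huxc.sub hvc.continuousOn)
      (fun t ht => (norm_sub_le _ _).trans (add_le_add (hM x t hx.le ht) (hvb t))) (by
        intro l hl
        have i1 := lapint l M hl (u x) huxc (fun t ht => hM x t hx.le ht)
        have i2 := lapint l _ hl v hvc.continuousOn (fun t _ => hvb t)
        simp only [mul_sub]
        rw [integral_sub i1 i2, sub_eq_zero, hlap l hl x hx.le]
        have e1 : ∫ t in Ioi (0:ℝ), (Real.exp (-(l * t)) : ℂ) * v t =
            ∫ t in Ioi (0:ℝ), (Real.exp (-(l * t)) : ℂ) * (∫ τ in (0:ℝ)..t, k (t - τ) * f τ) := by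
          apply setIntegral_congr_fun measurableSet_Ioi
          intro t ht
          simp only
          rw [conv_eq k f hf0 t ht]
        rw [e1, conv_lap k f Mk Mf hkc hkb hfc hfb l hl]
        congr 1
        · rw [← Kf_lap C q β c l x hq hqβ hx, ← integral_complex_ofReal]
          simp [hk]
        · apply setIntegral_congr_fun measurableSet_Ioi
          intro t ht
          simp only
          rw [hfp t ht, hbdry t ht]) t ht
    rw [sub_eq_zero] at hzero
    rw [hzero, hv]
    simp only
    rw [← conv_eq k f hf0 t ht, Lt, ← mul_assoc, intervalIntegral.integral_of_le ht.le,
      integral_Ioc_eq_integral_Ioo, ← integral_const_mul]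
    apply setIntegral_congr_fun measurableSet_Ioo
    intro τ hτ
    simp only
    rw [hfp τ hτ.1]
    have htτ : 0 < t - τ := by linarith [hτ.2]
    have hk1 : Kf C q β c x (t - τ) = t ^ α * ((α / 2) ^ α / (Real.Gamma (α / 2) * t ^ α)) *
        (x * (t - τ) ^ (-β) * Real.exp (-(α ^ 2) * x ^ q / (4 * (t - τ)))) := by
      have ha : -(c * x ^ q / (t - τ)) = -(α ^ 2) * x ^ q / (4 * (t - τ)) := by
        rw [hcdef]; field_simp
      have hb : t ^ α * ((α / 2) ^ α / (Real.Gamma (α / 2) * t ^ α)) = C := by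
        rw [hCdef]
        have : t ^ α ≠ 0 := by positivity
        field_simp
      rw [hb, Kf, ha]; ring
    rw [hk]
    simp only
    rw [hk1]
    push_cast
    ring
  · have hcf : ContinuousOn (fun p : ℝ × ℝ => fderiv ℝ (fun p : ℝ × ℝ => u p.1 p.2) p (0, 1))
        (Ioi 0 ×ˢ Ioi 0) :=
      (hu2.continuousOn_fderiv_of_isOpen hopen (by norm_num)).clm_apply continuousOn_const
    exact hcf.congr (fun p hp => (h3' p.1 p.2 hp.1 hp.2).deriv)
  · intro x t hx ht
    exact (((hx2 t ht).differentiableOn (by norm_num)).differentiableAt (Ioi_mem_nhds hx)).hasDerivAt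
  · intro x t hx ht
    have hd1 : ContDiffOn ℝ 1 (deriv (fun z => u z t)) (Ioi 0) :=
      (hx2 t ht).deriv_of_isOpen isOpen_Ioi (by norm_num)
    have hd2 := ((hd1.differentiableOn (by norm_num)).differentiableAt (Ioi_mem_nhds hx)).hasDerivAt
    refine hd2.congr_deriv ?_
    rw [hpde x t hx ht, iteratedDeriv_succ, iteratedDeriv_one, ← mul_assoc, ← Complex.ofReal_mul,
      ← Real.rpow_add hx]
    have : q - 2 + 2 * (α - 1) / α = 0 := by rw [hqdef]; field_simp; ring
    rw [this, Real.rpow_zero, Complex.ofReal_one, one_mul]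
  · intro x t hx ht
    exact (h3' x t hx ht).differentiableAt.hasDerivAt
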